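/- Let m, n ≥ 1 with m + n ≥ 3, and let H̃ be the mn×mn symmetric matrix indexed by edges of K_{m,n} whose (i,j) entry is the number of spanning trees containing edges i and j (diagonal entries 0). Then the eigenvalues of H̃ are −2m^{n−2}n^{m−2}, −m^{n−2}n^{m−1}, −m^{n−1}n^{m−2}, and m^{n−2}n^{m−2}(m+n−1)(m+n−2), with multiplicities (m−1)(n−1), n−1, m−1, and 1, respectively. -/

import Mathlib

/-- Iterating the partial map `h` from the given point eventually leaves its domain. -/
inductive ReachesRoot {A : Type*} (h : A → Option A) : A → Prop
  | root {a : A} : h a = none → ReachesRoot h a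
  | step {a b : A} : h a = some b → ReachesRoot h b → ReachesRoot h a

/-- The partial map `h`, read as a parent function, describes a forest of rooted trees. -/
def IsRooted {A : Type*} (h : A → Option A) : Prop := ∀ a, ReachesRoot h a

theorem ReachesRoot.ne_some_self {A : Type*} {h : A → Option A} {a : A} (ha : ReachesRoot h a) :
    h a ≠ some a := by
  induction ha with
  | root h0 => simp [h0]
  | step h1 _ ih =>
    intro h2
    rw [h1] at h2
    cases h2
    exact ih h1

/-- Replace the point `none` of `Option A` by the target `c` that it is mapped to. -/
def redirect {A : Type*} (c : Option (Option A)) : Option (Option A) → Option A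
  | none => none
  | some none => c.join
  | some (some b) => some b

theorem isRooted_option {A : Type*} (h : Option A → Option (Option A)) :
    IsRooted h ↔ h none ≠ some none ∧ IsRooted fun a => redirect (h none) (h (some a)) := by
  constructor
  · intro H
    refine ⟨(H none).ne_some_self, ?_⟩
    have key : ∀ x, ReachesRoot h x →
        (∀ a, x = some a → ReachesRoot (fun a => redirect (h none) (h (some a))) a) ∧
        (x = none → ∀ a, h none = some (some a) →
          ReachesRoot (fun a => redirect (h none) (h (some a))) a) := by
      intro x hx
      induction hx with
      | root h0 =>
        refine ⟨?_, ?_⟩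
        · rintro a rfl
          exact .root (by simp [h0, redirect])
        · rintro rfl a ha
          simp [h0] at ha
      | @step x b h1 _ ih =>
        refine ⟨?_, ?_⟩
        · rintro a rfl
          cases b with
          | some b => exact .step (b := b) (by simp [h1, redirect]) (ih.1 b rfl)
          | none =>
            rcases hn : h none with _ | _ | b
            · exact .root (by simp [h1, redirect])
            · exact absurd hn (H none).ne_some_self
            · rw [← hn]
              exact .step (b := b) (by simp [h1, hn, redirect]) (ih.2 rfl b hn)
        · rintro rfl a ha
          rw [h1] at ha
          exact ih.1 a (by simpa using ha)
    exact fun a => (key _ (H (some a))).1 a rfl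
  · rintro ⟨h0, H⟩
    have key : ∀ a, ReachesRoot (fun a => redirect (h none) (h (some a))) a →
        ReachesRoot h (some a) := by
      intro a ha
      induction ha with
      | @root a h1 =>
        rcases h2 : h (some a) with _ | _ | b
        · exact .root h2
        · rcases h3 : h none with _ | _ | c
          · exact .step h2 (.root h3)
          · exact absurd h3 h0
          · simp [h2, h3, redirect] at h1
        · simp [h2, redirect] at h1
      | @step a b h1 _ ih =>
        rcases h2 : h (some a) with _ | _ | c
        · exact .root h2
        · rcases h3 : h none with _ | _ | c
          · exact .step h2 (.root h3)
          · exact absurd h3 h0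
          · simp only [h2, h3, redirect, Option.join_some, Option.some.injEq] at h1
            subst h1
            exact .step h2 (.step h3 ih)
        · simp only [h2, redirect, Option.some.injEq] at h1
          subst h1
          exact .step h2 ih
    rintro (_ | a)
    · rcases h3 : h none with _ | _ | c
      · exact .root h3
      · exact absurd h3 h0
      · exact .step h3 (key c (H c))
    · exact key a (H a)

theorem ReachesRoot.of_equiv {A B : Type*} (e : A ≃ B) {h : B → Option B} {a : A}
    (ha : ReachesRoot h (e a)) : ReachesRoot (fun a => (h (e a)).map e.symm) a := by
  generalize hb : e a = b at ha
  induction ha generalizing a with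
  | root h0 => exact .root (by simp [hb, h0])
  | @step b c h1 _ ih =>
    exact .step (b := e.symm c) (by simp [hb, h1]) (ih (by simp))

theorem isRooted_equiv {A B : Type*} (e : A ≃ B) (h : B → Option B) :
    IsRooted (fun a => (h (e a)).map e.symm) ↔ IsRooted h := by
  refine ⟨fun H b => ?_, fun H a => .of_equiv e (H (e a))⟩
  have := ReachesRoot.of_equiv e.symm (a := b) (H _)
  simpa [Function.comp_def] using this

open Classical in
/-- The number of ways to let each `a : A` choose a parent `g (f a)` through `f : A → R` so that
a rooted forest results. -/
theorem card_isRooted_comp {A R : Type*} [Finite A] [Fintype R] (g : R → Option A) :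
    Nat.card {f : A → R // IsRooted (g ∘ f)} * Fintype.card R =
      (∑ r, if g r = none then 1 else 0) * Fintype.card R ^ Nat.card A := by
  induction A using Finite.induction_empty_option with
  | @of_equiv A B e ih =>
    have h1 := ih (fun r => (g r).map e.symm)
    rw [← Nat.card_congr e]
    simp only [Option.map_eq_none_iff] at h1
    rw [← h1]
    congr 1
    refine Nat.card_congr ((e.arrowCongr (Equiv.refl R)).symm.subtypeEquiv fun f => ?_)
    rw [← isRooted_equiv e]
    rfl
  | h_empty =>
    have : ∀ r, g r = none := fun r => by rcases g r with _ | ⟨⟨⟩⟩; rfl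
    have h2 : ∀ f : PEmpty → R, IsRooted (g ∘ f) := fun f a => a.elim
    simp [this, h2]
  | @h_option A _ ih =>
    have e : {f : Option A → R // IsRooted (g ∘ f)} ≃
        Σ r : R, {f : A → R // g r ≠ some none ∧ IsRooted ((fun x => redirect (g r) (g x)) ∘ f)} :=
      { toFun f := ⟨f.1 none, fun a => f.1 (some a), (isRooted_option _).1 f.2⟩
        invFun p := ⟨fun x => x.elim p.1 p.2.1, (isRooted_option _).2 p.2.2⟩
        left_inv f := by
          ext x
          cases x <;> rfl
        right_inv p := rfl }
    have : Fintype A := Fintype.ofFinite A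
    rw [Nat.card_congr e, Nat.card_sigma, Finset.sum_mul]
    have h1 : ∀ r, Nat.card {f : A → R // g r ≠ some none ∧
        IsRooted ((fun x => redirect (g r) (g x)) ∘ f)} * Fintype.card R =
        (∑ x, ((if g r ≠ some none ∧ g x = none then 1 else 0) +
          if g x = some none ∧ g r = none then 1 else 0)) * Fintype.card R ^ Nat.card A := by
      intro r
      by_cases hr : g r = some none
      · simp [hr]
      · simp only [ne_eq, hr, not_false_eq_true, true_and]
        rw [ih]
        congr 1
        refine Finset.sum_congr rfl fun x _ => ?_
        rcases g x with _ | _ | b <;> rcases h : g r with _ | _ | c <;> simp_all [redirect]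
    simp only [h1]
    rw [← Finset.sum_mul]
    simp only [Finset.sum_add_distrib]
    rw [Finset.sum_comm (f := fun r x => if g x = some none ∧ g r = none then 1 else 0),
      ← Finset.sum_add_distrib]
    simp only [← Finset.sum_add_distrib]
    have h2 : ∀ r x, ((if g r ≠ some none ∧ g x = none then 1 else 0) +
        if g r = some none ∧ g x = none then 1 else 0) = if g x = none then 1 else 0 := by
      intro r x
      by_cases hr : g r = some none <;> simp [hr]
    simp only [h2]
    simp only [Finset.sum_const, Finset.card_univ, Nat.card_eq_fintype_card, Fintype.card_option,
      smul_eq_mul]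
    ring

/-- The bipartite graph joining each vertex outside the root `Sum.inl none` to its parent. -/
def parentGraph {A R : Type*} (f : A → R) (g : R → Option A) : SimpleGraph (Option A ⊕ R) :=
  .fromRel fun u v =>
    (∃ r, u = .inr r ∧ v = .inl (g r)) ∨ ∃ a, u = .inl (some a) ∧ v = .inr (f a)

section

variable {A R : Type*} {f f' : A → R} {g g' : R → Option A}

@[simp]
theorem parentGraph_adj_inl_inr {x : Option A} {r : R} :
    (parentGraph f g).Adj (.inl x) (.inr r) ↔ g r = x ∨ ∃ a, x = some a ∧ f a = r := by
  simp only [parentGraph, SimpleGraph.fromRel_adj]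
  constructor
  · rintro ⟨-, (⟨_, h, _⟩ | ⟨a, h, h'⟩) | ⟨r', h, h'⟩ | ⟨a, h, _⟩⟩ <;> simp_all
  · rintro (rfl | ⟨a, rfl, rfl⟩) <;> simp

theorem parentGraph_le_iff {T : SimpleGraph (Option A ⊕ R)} :
    parentGraph f g ≤ T ↔
      (∀ r, T.Adj (.inr r) (.inl (g r))) ∧ ∀ a, T.Adj (.inl (some a)) (.inr (f a)) := by
  constructor
  · exact fun h => ⟨fun r => (h (by simp)).symm, fun a => h (by simp)⟩
  · rintro ⟨h1, h2⟩ u v h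
    simp only [parentGraph, SimpleGraph.fromRel_adj] at h
    obtain ⟨-, (⟨_, rfl, rfl⟩ | ⟨a, rfl, rfl⟩) | ⟨r', rfl, rfl⟩ | ⟨a, rfl, rfl⟩⟩ := h
    exacts [h1 _, h2 _, (h1 _).symm, (h2 _).symm]

theorem parentGraph_le_completeBipartiteGraph :
    parentGraph f g ≤ completeBipartiteGraph (Option A) R :=
  parentGraph_le_iff.2 (by simp)

theorem IsRooted.parentGraph_connected (h : IsRooted (g ∘ f)) : (parentGraph f g).Connected := by
  have hR : ∀ r, (parentGraph f g).Reachable (.inr r) (.inl (g r)) := fun r =>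
    ((parentGraph_le_iff.1 le_rfl).1 r).reachable
  have hA : ∀ a, (parentGraph f g).Reachable (.inl (some a)) (.inl (g (f a))) := fun a =>
    ((parentGraph_le_iff.1 le_rfl).2 a).reachable.trans (hR _)
  have hL : ∀ x, (parentGraph f g).Reachable (.inl x) (.inl none) := by
    rintro (_ | a)
    · rfl
    · induction h a with
      | @root a h0 =>
        have := hA a
        rwa [show g (f a) = none from h0] at this
      | @step a b h0 _ ih =>
        have := hA a
        rw [show g (f a) = some b from h0] at this
        exact this.trans ih
  have key : ∀ v, (parentGraph f g).Reachable v (.inl none) := by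
    rintro (x | r)
    · exact hL x
    · exact (hR r).trans (hL _)
  exact { preconnected := fun u v => (key u).trans (key v).symm, nonempty := ⟨.inl none⟩ }

theorem IsRooted.parentGraph_isTree [Finite A] [Finite R] (h : IsRooted (g ∘ f)) :
    (parentGraph f g).IsTree := by
  rw [SimpleGraph.isTree_iff_connected_and_card]
  refine ⟨h.parentGraph_connected, le_antisymm ?_
    h.parentGraph_connected.card_vert_le_card_edgeSet_add_one⟩
  let φ : A ⊕ R → Sym2 (Option A ⊕ R) :=
    Sum.elim (fun a => s(.inl (some a), .inr (f a))) fun r => s(.inl (g r), .inr r)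
  have hsub : (parentGraph f g).edgeSet ⊆ Set.range φ := by
    intro e he
    induction e with | _ u v
    rw [SimpleGraph.mem_edgeSet] at he
    have hle : parentGraph f g ≤ .fromEdgeSet (Set.range φ) := parentGraph_le_iff.2
      ⟨fun r => by
          rw [SimpleGraph.fromEdgeSet_adj]
          exact ⟨⟨.inr r, Sym2.eq_swap⟩, by simp⟩,
        fun a => by
          rw [SimpleGraph.fromEdgeSet_adj]
          exact ⟨⟨.inl a, rfl⟩, by simp⟩⟩
    exact ((SimpleGraph.fromEdgeSet_adj _).1 (hle he)).1
  have h1 : Nat.card (parentGraph f g).edgeSet ≤ Nat.card (A ⊕ R) :=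
    (Nat.card_mono (Set.finite_range φ) hsub).trans (Finite.card_range_le φ)
  rw [Nat.card_sum] at h1 ⊢
  rw [Finite.card_option]
  lia

theorem IsRooted.eq_of_parentGraph_eq (h : IsRooted (g ∘ f))
    (he : parentGraph f g = parentGraph f' g') (h' : IsRooted (g' ∘ f')) : f = f' ∧ g = g' := by
  have hB : ∀ x r, (g r = x ∨ ∃ a, x = some a ∧ f a = r) ↔
      (g' r = x ∨ ∃ a, x = some a ∧ f' a = r) := fun x r => by
    rw [← parentGraph_adj_inl_inr, he, parentGraph_adj_inl_inr]
  have hf : ∀ a, f a = f' a := by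
    intro a
    induction h a with
    | @root a h0 =>
      have h0 : g (f a) = none := h0
      have h1 := (hB (some a) (f a)).1 (.inr ⟨a, rfl, rfl⟩)
      have h2 := (hB none (f a)).1 (.inl h0)
      aesop
    | @step a b h0 hb ih =>
      have h0 : g (f a) = some b := h0
      have h1 := (hB (some a) (f a)).1 (.inr ⟨a, rfl, rfl⟩)
      have h2 := (hB (some b) (f a)).1 (.inl h0)
      have h3 := (h a).ne_some_self
      have h4 := hb.ne_some_self
      simp only [Function.comp_apply, ne_eq] at h3 h4
      aesop
  have hf := funext hf
  subst hf
  refine ⟨rfl, funext fun r => ?_⟩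
  rcases (hB (g r) r).1 (.inl rfl) with h1 | ⟨a, h1, rfl⟩
  · exact h1.symm
  · exact absurd h1 (h a).ne_some_self

theorem SimpleGraph.Connected.exists_adj_dist_lt {V : Type*} {G : SimpleGraph V}
    (hG : G.Connected) {u v : V} (h : v ≠ u) : ∃ w, G.Adj v w ∧ G.dist w u < G.dist v u := by
  obtain ⟨p, hp⟩ := hG.exists_walk_length_eq_dist v u
  cases p with
  | nil => exact absurd rfl h
  | cons hadj q => exact ⟨_, hadj, (SimpleGraph.dist_le q).trans_lt (by simp [← hp])⟩

theorem SimpleGraph.IsTree.exists_parentGraph_eq {T : SimpleGraph (Option A ⊕ R)} (hT : T.IsTree)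
    (hle : T ≤ completeBipartiteGraph (Option A) R) :
    ∃ (f : A → R) (g : R → Option A), IsRooted (g ∘ f) ∧ parentGraph f g = T := by
  have hA : ∀ a : A, ∃ r : R, T.Adj (.inl (some a)) (.inr r) ∧
      T.dist (.inr r) (.inl none) < T.dist (.inl (some a)) (.inl none) := by
    intro a
    obtain ⟨w, h1, h2⟩ := hT.connected.exists_adj_dist_lt
      (u := .inl none) (v := .inl (some a)) (by simp)
    rcases w with x | r
    · simpa using hle h1
    · exact ⟨r, h1, h2⟩
  have hR : ∀ r : R, ∃ x : Option A, T.Adj (.inr r) (.inl x) ∧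
      T.dist (.inl x) (.inl none) < T.dist (.inr r) (.inl none) := by
    intro r
    obtain ⟨w, h1, h2⟩ := hT.connected.exists_adj_dist_lt
      (u := .inl none) (v := .inr r) (by simp)
    rcases w with x | r
    · exact ⟨x, h1, h2⟩
    · simpa using hle h1
  choose f hf hf' using hA
  choose g hg hg' using hR
  have hroot : IsRooted (g ∘ f) := by
    intro a
    induction hd : T.dist (.inl (some a)) (.inl none) using Nat.strong_induction_on generalizing a
      with | _ d ih
    rcases h : g (f a) with _ | b
    · exact .root h
    · refine .step h (ih _ ?_ b rfl)
      rw [← hd, ← h]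
      exact (hg' _).trans (hf' _)
  have hsub := parentGraph_le_iff.2 ⟨hg, hf⟩
  exact ⟨f, g, hroot, hsub.antisymm
    ((SimpleGraph.isTree_iff_minimal_connected.1 hT).2 hroot.parentGraph_connected hsub)⟩

end

open Classical in
theorem card_forall_mem_eq_mul_pow {R X : Type*} [Fintype R] [Fintype X] (S : Finset R) (x : X) :
    (∑ g : R → X, if ∀ s ∈ S, g s = x then 1 else 0) * Fintype.card X ^ S.card =
      Fintype.card X ^ Fintype.card R := by
  have h : (Finset.univ.filter fun g : R → X => ∀ s ∈ S, g s = x) =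
      Fintype.piFinset fun r => if r ∈ S then {x} else Finset.univ := by
    ext g
    simp only [Finset.mem_filter, Finset.mem_univ, true_and, Fintype.mem_piFinset]
    refine forall_congr' fun r => ?_
    by_cases hr : r ∈ S <;> simp [hr]
  rw [Finset.sum_boole, h, Fintype.card_piFinset]
  simp only [apply_ite Finset.card, Finset.card_singleton, Finset.card_univ]
  rw [Finset.prod_ite]
  simp only [Finset.prod_const, one_pow, one_mul, Nat.cast_id, ← pow_add]
  congr 1
  rw [← Finset.card_univ, ← Finset.card_filter_add_card_filter_not (s := Finset.univ) (· ∈ S)]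
  simp [add_comm]

theorem card_trees_adj_root {A R : Type*} [Fintype A] [Fintype R] (S : Finset R) :
    {T : SimpleGraph (Option A ⊕ R) | T ≤ completeBipartiteGraph (Option A) R ∧ T.IsTree ∧
        ∀ s ∈ S, T.Adj (.inl none) (.inr s)}.ncard * Fintype.card R *
          (Fintype.card A + 1) ^ (S.card + 1) =
      Fintype.card R ^ Fintype.card A * (Fintype.card A + 1) ^ Fintype.card R *
        (S.card * (Fintype.card A + 1) + (Fintype.card R - S.card)) := by
  classical
  have himg : {T : SimpleGraph (Option A ⊕ R) | T ≤ completeBipartiteGraph (Option A) R ∧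
      T.IsTree ∧ ∀ s ∈ S, T.Adj (.inl none) (.inr s)} =
      (fun p : (R → Option A) × (A → R) => parentGraph p.2 p.1) ''
        {p | IsRooted (p.1 ∘ p.2) ∧ ∀ s ∈ S, p.1 s = none} := by
    ext T
    simp only [Set.mem_ofPred_eq, Set.mem_image, Prod.exists]
    constructor
    · rintro ⟨h1, h2, h3⟩
      obtain ⟨f, g, h4, rfl⟩ := h2.exists_parentGraph_eq h1
      exact ⟨g, f, ⟨h4, fun s hs => by simpa using h3 s hs⟩, rfl⟩
    · rintro ⟨g, f, ⟨h1, h2⟩, rfl⟩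
      exact ⟨parentGraph_le_completeBipartiteGraph, h1.parentGraph_isTree,
        fun s hs => by simpa using h2 s hs⟩
  have hinj : Set.InjOn (fun p : (R → Option A) × (A → R) => parentGraph p.2 p.1)
      {p | IsRooted (p.1 ∘ p.2) ∧ ∀ s ∈ S, p.1 s = none} := by
    rintro ⟨g, f⟩ ⟨h1, -⟩ ⟨g', f'⟩ ⟨h1', -⟩ he
    obtain ⟨rfl, rfl⟩ := h1.eq_of_parentGraph_eq he h1'
    rfl
  have hcard : {p : (R → Option A) × (A → R) | IsRooted (p.1 ∘ p.2) ∧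
      ∀ s ∈ S, p.1 s = none}.ncard = ∑ g : R → Option A,
        (if ∀ s ∈ S, g s = none then 1 else 0) * Nat.card {f : A → R // IsRooted (g ∘ f)} := by
    let e : {p : (R → Option A) × (A → R) | IsRooted (p.1 ∘ p.2) ∧ ∀ s ∈ S, p.1 s = none} ≃
        Σ g : R → Option A, {f : A → R // IsRooted (g ∘ f) ∧ ∀ s ∈ S, g s = none} :=
      { toFun p := ⟨p.1.1, p.1.2, p.2⟩
        invFun p := ⟨(p.1, p.2.1), p.2.2⟩ }
    rw [← Nat.card_coe_set_eq, Nat.card_congr e, Nat.card_sigma]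
    refine Finset.sum_congr rfl fun g _ => ?_
    by_cases h : ∀ s ∈ S, g s = none
    · rw [if_pos h, one_mul]
      exact Nat.card_congr (Equiv.subtypeEquivRight fun f => and_iff_left h)
    · simp [h]
  have hins : ∀ (g : R → Option A) (r : R), ((if ∀ s ∈ S, g s = none then 1 else 0) *
      if g r = none then 1 else 0) = if ∀ s ∈ insert r S, g s = none then 1 else 0 := by
    intro g r
    simp only [Finset.forall_mem_insert]
    by_cases h1 : g r = none <;> simp [h1]
  have hr : ∀ r : R, (∑ g : R → Option A, if ∀ s ∈ insert r S, g s = none then 1 else 0) *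
      (Fintype.card A + 1) ^ (S.card + 1) = (Fintype.card A + 1) ^ Fintype.card R *
        if r ∈ S then Fintype.card A + 1 else 1 := by
    intro r
    have := card_forall_mem_eq_mul_pow (insert r S) (none : Option A)
    rw [Fintype.card_option] at this
    rw [← this]
    by_cases h : r ∈ S
    · simp [h, pow_succ, mul_assoc]
    · simp [h]
  have hsum : (∑ r : R, if r ∈ S then Fintype.card A + 1 else 1) =
      S.card * (Fintype.card A + 1) + (Fintype.card R - S.card) := by
    rw [Finset.sum_ite, ← Finset.card_compl, Finset.compl_eq_univ_sdiff, Finset.sdiff_eq_filter]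
    simp
  rw [himg, hinj.ncard_image, hcard, Finset.sum_mul]
  simp only [mul_assoc, card_isRooted_comp]
  simp only [← mul_assoc, Nat.card_eq_fintype_card]
  rw [← Finset.sum_mul]
  simp only [Finset.mul_sum, hins]
  rw [Finset.sum_comm, mul_right_comm, Finset.sum_mul]
  simp only [hr]
  rw [← Finset.mul_sum, hsum]
  ring

theorem SimpleGraph.Iso.ncard_isTree_adj_adj {V W : Type*} {K : SimpleGraph V} {K' : SimpleGraph W}
    (φ : K ≃g K') (u v u' v' : V) :
    {T : SimpleGraph W | T ≤ K' ∧ T.IsTree ∧ T.Adj (φ u) (φ v) ∧ T.Adj (φ u') (φ v')}.ncard =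
      {T : SimpleGraph V | T ≤ K ∧ T.IsTree ∧ T.Adj u v ∧ T.Adj u' v'}.ncard := by
  rw [← Nat.card_coe_set_eq, ← Nat.card_coe_set_eq]
  refine (Nat.card_congr (φ.toEquiv.simpleGraph.subtypeEquiv fun T => ?_)).symm
  have hadj : ∀ x y, (φ.toEquiv.simpleGraph T).Adj (φ x) (φ y) ↔ T.Adj x y := fun x y => by
    change T.Adj (φ.symm (φ x)) (φ.symm (φ y)) ↔ _
    rw [φ.symm_apply_apply, φ.symm_apply_apply]
  let ψ : T ≃g φ.toEquiv.simpleGraph T :=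
    { toEquiv := φ.toEquiv
      map_rel_iff' := hadj _ _ }
  have hle : φ.toEquiv.simpleGraph T ≤ K' ↔ T ≤ K := by
    constructor
    · intro h x y hxy
      exact φ.map_adj_iff.1 (h ((hadj x y).2 hxy))
    · intro h x y hxy
      exact φ.symm.map_adj_iff.1 (h hxy)
  exact and_congr hle.symm (and_congr ψ.isTree_iff (and_congr (hadj _ _).symm (hadj _ _).symm))

/-- The number of spanning trees of the complete bipartite graph that contain two given edges. -/
noncomputable def numTrees {L R : Type*} (p q : L × R) : ℕ :=
  {T : SimpleGraph (L ⊕ R) | T ≤ completeBipartiteGraph L R ∧ T.IsTree ∧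
    T.Adj (.inl p.1) (.inr p.2) ∧ T.Adj (.inl q.1) (.inr q.2)}.ncard

theorem numTrees_map {L R L' R' : Type*} (e : L ≃ L') (e' : R ≃ R') (p q : L × R) :
    numTrees (Prod.map e e' p) (Prod.map e e' q) = numTrees p q :=
  (SimpleGraph.completeBipartiteGraphCongr e e').ncard_isTree_adj_adj (.inl p.1) (.inr p.2)
    (.inl q.1) (.inr q.2)

theorem numTrees_swap {L R : Type*} (p q : L × R) : numTrees p.swap q.swap = numTrees p q := by
  let φ : completeBipartiteGraph L R ≃g completeBipartiteGraph R L :=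
    { toEquiv := Equiv.sumComm L R
      map_rel_iff' := by simp [or_comm] }
  rw [numTrees, numTrees, ← φ.ncard_isTree_adj_adj]
  congr! 5
  exact and_congr (SimpleGraph.adj_comm _ _ _) (SimpleGraph.adj_comm _ _ _)

theorem numTrees_same_left_mul {m n : ℕ} (i : Fin m) (S : Finset (Fin n)) (j j' : Fin n)
    (hS : S = {j, j'}) :
    (numTrees (i, j) (i, j') : ℚ) * n ^ 2 * m ^ (S.card + 1) =
      n ^ m * m ^ n * (S.card * m + n - S.card) := by
  obtain _ | m := m
  · exact i.elim0
  have h := card_trees_adj_root (A := Fin m) S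
  have h1 := numTrees_map (finSuccEquiv' i) (Equiv.refl (Fin n)) (i, j) (i, j')
  have h2 : ((n - S.card : ℕ) : ℚ) = n - S.card := by
    rw [Nat.cast_sub]
    simpa using S.card_le_univ
  have h3 : numTrees (Prod.map (finSuccEquiv' i) (Equiv.refl (Fin n)) (i, j))
      (Prod.map (finSuccEquiv' i) (Equiv.refl (Fin n)) (i, j')) =
      {T : SimpleGraph (Option (Fin m) ⊕ Fin n) | T ≤ completeBipartiteGraph (Option (Fin m)) _ ∧
        T.IsTree ∧ ∀ s ∈ S, T.Adj (.inl none) (.inr s)}.ncard := by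
    simp [numTrees, hS]
  rw [← h3, h1] at h
  simp only [Fintype.card_fin] at h
  have h := congrArg (Nat.cast (R := ℚ)) h
  push_cast [h2] at h ⊢
  linear_combination (n : ℚ) * h

section

variable {m n : ℕ}

theorem numTrees_self (p : Fin m × Fin n) :
    (numTrees p p : ℚ) = n ^ m * m ^ n / (n ^ 3 * m ^ 3) * (m * n * (m + n - 1)) := by
  have hm : (m : ℚ) ≠ 0 := by exact_mod_cast p.1.pos.ne'
  have hn : (n : ℚ) ≠ 0 := by exact_mod_cast p.2.pos.ne'
  have h := numTrees_same_left_mul p.1 {p.2} p.2 p.2 (by simp)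
  simp only [Finset.card_singleton, Nat.cast_one] at h
  field_simp
  linear_combination h

theorem numTrees_same_left (i : Fin m) {j j' : Fin n} (h : j ≠ j') :
    (numTrees (i, j) (i, j') : ℚ) = n ^ m * m ^ n / (n ^ 3 * m ^ 3) * (n * (2 * m + n - 2)) := by
  have hm : (m : ℚ) ≠ 0 := by exact_mod_cast i.pos.ne'
  have hn : (n : ℚ) ≠ 0 := by exact_mod_cast j.pos.ne'
  have h := numTrees_same_left_mul i {j, j'} j j' rfl
  simp only [Finset.card_pair ‹j ≠ j'›, Nat.cast_ofNat] at h
  field_simp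
  linear_combination h

theorem numTrees_same_right {i i' : Fin m} (h : i ≠ i') (j : Fin n) :
    (numTrees (i, j) (i', j) : ℚ) = n ^ m * m ^ n / (n ^ 3 * m ^ 3) * (m * (2 * n + m - 2)) := by
  rw [← numTrees_swap]
  simp only [Prod.swap_prod_mk]
  rw [numTrees_same_left j h]
  ring

open Classical in
theorem SimpleGraph.IsTree.card_filter_adj {L R : Type*} [Fintype L] [Fintype R]
    {T : SimpleGraph (L ⊕ R)} (hT : T.IsTree) (hle : T ≤ completeBipartiteGraph L R) :
    (Finset.univ.filter fun q : L × R => T.Adj (.inl q.1) (.inr q.2)).card + 1 =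
      Fintype.card L + Fintype.card R := by
  rw [← Fintype.card_sum, ← hT.card_edgeFinset]
  congr 1
  refine Finset.card_bij (fun q _ => s(.inl q.1, .inr q.2)) ?_ ?_ ?_
  · simp
  · rintro ⟨i, j⟩ - ⟨i', j'⟩ - h
    simpa using h
  · intro e he
    induction e with | _ u v
    rw [SimpleGraph.mem_edgeFinset, SimpleGraph.mem_edgeSet] at he
    rcases u with i | j <;> rcases v with i' | j'
    · simpa using hle he
    · exact ⟨(i, j'), by simpa using he, rfl⟩
    · exact ⟨(i', j), by simpa using he.symm, Sym2.eq_swap⟩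
    · simpa using hle he

theorem sum_numTrees {L R : Type*} [Fintype L] [Fintype R] (p : L × R) :
    ∑ q, numTrees p q + numTrees p p = (Fintype.card L + Fintype.card R) * numTrees p p := by
  classical
  have h : ∀ q : L × R, numTrees p q = ∑ T ∈ Finset.univ.filter fun T : SimpleGraph (L ⊕ R) =>
      T ≤ completeBipartiteGraph L R ∧ T.IsTree ∧ T.Adj (.inl p.1) (.inr p.2),
      if T.Adj (.inl q.1) (.inr q.2) then 1 else 0 := by
    intro q
    rw [Finset.sum_boole, Finset.filter_filter, numTrees, Set.ncard_eq_toFinset_card']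
    simp [and_assoc]
  have h' : numTrees p p = ∑ T ∈ Finset.univ.filter fun T : SimpleGraph (L ⊕ R) =>
      T ≤ completeBipartiteGraph L R ∧ T.IsTree ∧ T.Adj (.inl p.1) (.inr p.2), 1 := by
    rw [h]
    exact Finset.sum_congr rfl fun T hT => if_pos (Finset.mem_filter.1 hT).2.2.2
  rw [h']
  simp only [h]
  rw [Finset.sum_comm, ← Finset.sum_add_distrib, Finset.mul_sum]
  refine Finset.sum_congr rfl fun T hT => ?_
  obtain ⟨-, h1, h2, -⟩ := Finset.mem_filter.1 hT
  rw [Finset.sum_boole, Nat.cast_id, h2.card_filter_adj h1, mul_one]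

theorem numTrees_disjoint {i i' : Fin m} (hi : i ≠ i') {j j' : Fin n} (hj : j ≠ j') :
    (numTrees (i, j) (i', j') : ℚ) =
      n ^ m * m ^ n / (n ^ 3 * m ^ 3) * ((m + n) * (m + n - 2)) := by
  have hm : (m : ℚ) ≠ 0 := by exact_mod_cast i.pos.ne'
  have hn : (n : ℚ) ≠ 0 := by exact_mod_cast j.pos.ne'
  have hm1 : (m : ℚ) - 1 ≠ 0 := by
    rw [sub_ne_zero]
    norm_cast
    rintro rfl
    exact hi (Subsingleton.elim _ _)
  have hn1 : (n : ℚ) - 1 ≠ 0 := by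
    rw [sub_ne_zero]
    norm_cast
    rintro rfl
    exact hj (Subsingleton.elim _ _)
  have hs := congrArg (Nat.cast (R := ℚ)) (sum_numTrees (i, j))
  set k : ℚ := n ^ m * m ^ n / (n ^ 3 * m ^ 3) with hk
  obtain ⟨c, hc⟩ : ∃ c : ℚ, (numTrees (i, j) (i', j') : ℚ) = c := ⟨_, rfl⟩
  have hq : ∀ x y, (numTrees (i, j) (x, y) : ℚ) =
      c + (if i = x then k * (n * (2 * m + n - 2)) - c else 0) +
        (if j = y then k * (m * (2 * n + m - 2)) - c else 0) +
        if i = x then if j = y then k * (m * n * (m + n - 1)) + c - k * (n * (2 * m + n - 2)) -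
          k * (m * (2 * n + m - 2)) else 0 else 0 := by
    intro x y
    by_cases hx : i = x <;> by_cases hy : j = y
    · subst hx hy
      simp only [if_true]
      rw [numTrees_self, ← hk]
      ring
    · subst hx
      simp only [hy, if_true, if_false]
      rw [numTrees_same_left i hy, ← hk]
      ring
    · subst hy
      simp only [hx, if_true, if_false]
      rw [numTrees_same_right hx j, ← hk]
      ring
    · have := numTrees_map (Equiv.swap i' x) (Equiv.swap j' y) (i, j) (i', j')
      simp only [Prod.map, Equiv.swap_apply_left, Equiv.swap_apply_of_ne_of_ne hi hx,
        Equiv.swap_apply_of_ne_of_ne hj hy] at this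
      simp [hx, hy, this, hc]
  rw [Fintype.sum_prod_type] at hs
  push_cast [hq] at hs
  simp only [Finset.sum_add_distrib] at hs
  simp at hs
  rw [hc]
  refine mul_left_cancel₀ (mul_ne_zero hm1 hn1) ?_
  linear_combination hs

end

section

open Matrix Kronecker Polynomial

theorem Matrix.det_one_kronecker_add_ones_kronecker {ι κ F : Type*} [Fintype ι] [DecidableEq ι]
    [Fintype κ] [DecidableEq κ] [Nonempty ι] [Field F] {P : Matrix κ κ F} (hP : P.det ≠ 0)
    (Q : Matrix κ κ F) :
    ((1 : Matrix ι ι F) ⊗ₖ P + (of fun _ _ => 1 : Matrix ι ι F) ⊗ₖ Q).det =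
      P.det ^ (Fintype.card ι - 1) * (P + (Fintype.card ι : F) • Q).det := by
  have hU : IsUnit P.det := isUnit_iff_ne_zero.2 hP
  have hJ : (of fun _ _ => 1 : Matrix ι ι F) =
      (of fun _ _ => 1 : Matrix ι Unit F) * (of fun _ _ => 1 : Matrix Unit ι F) := by
    ext
    simp [mul_apply]
  have h1 : (of fun _ _ => 1 : Matrix Unit ι F) * (of fun _ _ => 1 : Matrix ι Unit F) =
      (Fintype.card ι : F) • 1 := by
    ext
    simp [mul_apply]
  have hL : (1 : Matrix ι ι F) ⊗ₖ P + (of fun _ _ => 1 : Matrix ι ι F) ⊗ₖ Q =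
      ((1 : Matrix ι ι F) ⊗ₖ P) * (1 + ((of fun _ _ => 1 : Matrix ι Unit F) ⊗ₖ (P⁻¹ * Q)) *
        ((of fun _ _ => 1 : Matrix Unit ι F) ⊗ₖ (1 : Matrix κ κ F))) := by
    rw [← mul_kronecker_mul, ← hJ, Matrix.mul_add, Matrix.mul_one, ← mul_kronecker_mul,
      Matrix.one_mul, Matrix.mul_one, mul_nonsing_inv_cancel_left _ _ hU]
  have hR : P + (Fintype.card ι : F) • Q = P * (1 + (Fintype.card ι : F) • (P⁻¹ * Q)) := by
    rw [Matrix.mul_add, Matrix.mul_one, Matrix.mul_smul, mul_nonsing_inv_cancel_left _ _ hU]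
  have h2 : (1 + (Fintype.card ι : F) • (1 : Matrix Unit Unit F) ⊗ₖ (P⁻¹ * Q)).det =
      (1 + (Fintype.card ι : F) • (P⁻¹ * Q)).det := by
    rw [← det_reindex_self (Equiv.punitProd κ).symm]
    congr 1
    ext ⟨_, i⟩ ⟨_, j⟩
    simp [one_apply]
  rw [hL, det_mul, det_one_add_mul_comm, ← mul_kronecker_mul, h1, Matrix.one_mul,
    smul_kronecker, h2, hR, det_mul, det_kronecker, det_one, one_pow, one_mul, ← mul_assoc,
    ← pow_succ, Nat.sub_add_cancel Fintype.card_pos]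

theorem Matrix.det_smul_one_add_smul_ones {κ F : Type*} [Fintype κ] [DecidableEq κ] [Nonempty κ]
    [Field F] {a : F} (ha : a ≠ 0) (b : F) :
    (a • (1 : Matrix κ κ F) + b • of fun _ _ => 1).det =
      a ^ (Fintype.card κ - 1) * (a + Fintype.card κ * b) := by
  have h := det_one_kronecker_add_ones_kronecker (ι := κ) (P := (a • 1 : Matrix Unit Unit F))
    (by simpa) (b • 1)
  rw [← det_reindex_self (Equiv.prodPUnit κ).symm]
  convert h using 2
  · ext ⟨i, _⟩ ⟨j, _⟩
    simp [mul_comm]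
  · simp
  · simp

theorem Matrix.det_of_equality_pattern {ι κ F : Type*} [Fintype ι] [DecidableEq ι] [Nonempty ι]
    [Fintype κ] [DecidableEq κ] [Nonempty κ] [Field F] {a b c : F} (d : F) (ha : a ≠ 0)
    (hab : a + Fintype.card κ * b ≠ 0) (hac : a + Fintype.card ι * c ≠ 0) :
    (of fun p q : ι × κ => (if p.1 = q.1 then if p.2 = q.2 then a else 0 else 0) +
        (if p.1 = q.1 then b else 0) + (if p.2 = q.2 then c else 0) + d).det =
      a ^ ((Fintype.card ι - 1) * (Fintype.card κ - 1)) *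
        (a + Fintype.card κ * b) ^ (Fintype.card ι - 1) *
        (a + Fintype.card ι * c) ^ (Fintype.card κ - 1) *
        (a + Fintype.card κ * b + Fintype.card ι * c + Fintype.card ι * Fintype.card κ * d) := by
  have hP := det_smul_one_add_smul_ones (κ := κ) ha b
  have hP0 : (a • (1 : Matrix κ κ F) + b • of fun _ _ => 1).det ≠ 0 := by
    rw [hP]
    exact mul_ne_zero (pow_ne_zero _ ha) hab
  have h := det_one_kronecker_add_ones_kronecker (ι := ι) hP0 (c • 1 + d • of fun _ _ => 1)
  have hPQ : a • (1 : Matrix κ κ F) + b • (of fun _ _ => 1) +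
      (Fintype.card ι : F) • (c • 1 + d • of fun _ _ => 1) =
      (a + Fintype.card ι * c) • (1 : Matrix κ κ F) +
        (b + Fintype.card ι * d) • of fun _ _ => 1 := by
    module
  rw [hPQ, det_smul_one_add_smul_ones hac, hP] at h
  convert h using 1
  · congr 1
    ext ⟨i, j⟩ ⟨i', j'⟩
    by_cases h1 : i = i' <;> by_cases h2 : j = j' <;> simp [h1, h2]
    ring
  · rw [mul_pow, ← pow_mul, mul_comm (Fintype.card ι - 1)]
    ring

theorem Matrix.charpoly_of_equality_pattern {ι κ F : Type*} [Fintype ι] [DecidableEq ι]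
    [Nonempty ι] [Fintype κ] [DecidableEq κ] [Nonempty κ] [Field F] [Infinite F] (a b c d : F) :
    (of fun p q : ι × κ => (if p.1 = q.1 then if p.2 = q.2 then a else 0 else 0) +
        (if p.1 = q.1 then b else 0) + (if p.2 = q.2 then c else 0) + d).charpoly =
      (X - C a) ^ ((Fintype.card ι - 1) * (Fintype.card κ - 1)) *
        (X - C (a + Fintype.card κ * b)) ^ (Fintype.card ι - 1) *
        (X - C (a + Fintype.card ι * c)) ^ (Fintype.card κ - 1) *
        (X - C (a + Fintype.card κ * b + Fintype.card ι * c +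
          Fintype.card ι * Fintype.card κ * d)) := by
  refine Polynomial.eq_of_infinite_eval_eq _ _ ?_
  refine (Set.Finite.infinite_compl (s := {a, a + Fintype.card κ * b, a + Fintype.card ι * c})
    (by simp)).mono fun x hx => ?_
  simp only [Set.mem_compl_iff, Set.mem_insert_iff, Set.mem_singleton_iff, not_or] at hx
  obtain ⟨h1, h2, h3⟩ := hx
  have h := det_of_equality_pattern (ι := ι) (κ := κ) (a := x - a) (b := -b) (c := -c) (-d)
    (sub_ne_zero.2 h1) (fun h => h2 (by linear_combination h)) fun h => h3 (by linear_combination h)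
  rw [Set.mem_ofPred_eq, eval_charpoly]
  simp only [eval_mul, eval_pow, eval_sub, eval_X, eval_C]
  convert h using 1
  · congr 1
    ext ⟨i, j⟩ ⟨i', j'⟩
    by_cases h1 : i = i' <;> by_cases h2 : j = j' <;> simp [h1, h2] <;> ring
  · congr 1
    · congr 1
      · congr 2
        ring
      · congr 1
        ring
    · ring

end

theorem charpoly_numTrees {m n : ℕ} (hm : m ≠ 0) (hn : n ≠ 0) {k : ℚ}
    (hk : (n ^ m * m ^ n / (n ^ 3 * m ^ 3) : ℚ) = k) :
    (Matrix.of fun p q : Fin m × Fin n => if p = q then 0 else (numTrees p q : ℚ)).charpoly =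
      (Polynomial.X - Polynomial.C (k * (-2 * m * n))) ^ ((m - 1) * (n - 1)) *
        (Polynomial.X - Polynomial.C (-(k * (m * n ^ 2)))) ^ (n - 1) *
        (Polynomial.X - Polynomial.C (-(k * (m ^ 2 * n)))) ^ (m - 1) *
        (Polynomial.X - Polynomial.C (k * (m * n * (m + n - 1) * (m + n - 2)))) := by
  have : NeZero m := ⟨hm⟩
  have : NeZero n := ⟨hn⟩
  have hH : (Matrix.of fun p q : Fin m × Fin n => if p = q then 0 else (numTrees p q : ℚ)) =
      Matrix.of fun p q => (if p.1 = q.1 then if p.2 = q.2 then k * (-2 * m * n) else 0 else 0) +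
        (if p.1 = q.1 then k * (m * (2 - m)) else 0) +
        (if p.2 = q.2 then k * (n * (2 - n)) else 0) + k * ((m + n) * (m + n - 2)) := by
    ext ⟨i, j⟩ ⟨i', j'⟩
    simp only [Matrix.of_apply, Prod.mk.injEq]
    by_cases h1 : i = i' <;> by_cases h2 : j = j'
    · simp only [h1, h2, and_self, if_true]
      ring
    · subst h1
      simp only [h2, and_false, if_true, if_false]
      rw [numTrees_same_left i h2, hk]
      ring
    · subst h2
      simp only [h1, false_and, if_true, if_false]
      rw [numTrees_same_right h1 j, hk]
      ring
    · simp only [h1, h2, false_and, if_false]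
      rw [numTrees_disjoint h1 h2, hk]
      ring
  rw [hH, Matrix.charpoly_of_equality_pattern, Fintype.card_fin, Fintype.card_fin,
    mul_right_comm (_ ^ ((m - 1) * (n - 1)))]
  ring_nf

/-- Eigenvalues with multiplicities (encoded via the characteristic polynomial) of the
`mn × mn` matrix `H̃` indexed by edges of `K_{m,n}`, with off-diagonal `(i,j)` entry the
number of spanning trees containing both edges and diagonal `0`. -/
theorem stmt_11 (m n : ℕ) (hm : 1 ≤ m) (hn : 1 ≤ n) (hmn : 3 ≤ m + n) :
    let H : Matrix (Fin m × Fin n) (Fin m × Fin n) ℚ :=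
      Matrix.of fun p q => if p = q then 0 else
        ({T : SimpleGraph (Fin m ⊕ Fin n) |
            T ≤ completeBipartiteGraph (Fin m) (Fin n) ∧ T.IsTree ∧
            s(Sum.inl p.1, Sum.inr p.2) ∈ T.edgeSet ∧
            s(Sum.inl q.1, Sum.inr q.2) ∈ T.edgeSet}.ncard : ℚ)
    H.charpoly
      = (Polynomial.X - Polynomial.C
            (-2 * (m : ℚ) ^ ((n : ℤ) - 2) * (n : ℚ) ^ ((m : ℤ) - 2))) ^ ((m - 1) * (n - 1)) *
        (Polynomial.X - Polynomial.C
            (-((m : ℚ) ^ ((n : ℤ) - 2) * (n : ℚ) ^ ((m : ℤ) - 1)))) ^ (n - 1) *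
        (Polynomial.X - Polynomial.C
            (-((m : ℚ) ^ ((n : ℤ) - 1) * (n : ℚ) ^ ((m : ℤ) - 2)))) ^ (m - 1) *
        (Polynomial.X - Polynomial.C
            ((m : ℚ) ^ ((n : ℤ) - 2) * (n : ℚ) ^ ((m : ℤ) - 2) *
              ((m : ℚ) + (n : ℚ) - 1) * ((m : ℚ) + (n : ℚ) - 2))) := by
  intro H
  have hm0 : (m : ℚ) ≠ 0 := Nat.cast_ne_zero.2 (by lia)
  have hn0 : (n : ℚ) ≠ 0 := Nat.cast_ne_zero.2 (by lia)
  obtain ⟨k, hk⟩ : ∃ k : ℚ, (n ^ m * m ^ n / (n ^ 3 * m ^ 3) : ℚ) = k := ⟨_, rfl⟩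
  have h1 : -2 * (m : ℚ) ^ ((n : ℤ) - 2) * (n : ℚ) ^ ((m : ℤ) - 2) = k * (-2 * m * n) := by
    rw [zpow_sub₀ hm0, zpow_sub₀ hn0, zpow_natCast, zpow_natCast, ← hk]
    simp only [zpow_ofNat]
    field_simp
  have h2 : (m : ℚ) ^ ((n : ℤ) - 2) * (n : ℚ) ^ ((m : ℤ) - 1) = k * (m * n ^ 2) := by
    rw [zpow_sub₀ hm0, zpow_sub₀ hn0, zpow_natCast, zpow_natCast, ← hk]
    simp only [zpow_ofNat]
    field_simp
  have h3 : (m : ℚ) ^ ((n : ℤ) - 1) * (n : ℚ) ^ ((m : ℤ) - 2) = k * (m ^ 2 * n) := by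
    rw [zpow_sub₀ hm0, zpow_sub₀ hn0, zpow_natCast, zpow_natCast, ← hk]
    simp only [zpow_ofNat]
    field_simp
  have h4 : (m : ℚ) ^ ((n : ℤ) - 2) * (n : ℚ) ^ ((m : ℤ) - 2) * ((m : ℚ) + (n : ℚ) - 1) *
      ((m : ℚ) + (n : ℚ) - 2) = k * (m * n * (m + n - 1) * (m + n - 2)) := by
    linear_combination (-(m + n - 1) * (m + n - 2) / 2 : ℚ) * h1
  rw [h1, h2, h3, h4]
  exact charpoly_numTrees (by lia) (by lia) hk
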